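/- Let P be a simple polygon and W a witness set of P; assume Vis(u) equals the closure of its interior for every u ∈ W. Let w, v′ ∈ W be distinct, and suppose a point x ∈ Vis(w) is visible from some point y ∈ Vis(v′). Then there exist v ∈ W adjacent to w in GCon(W), a connected component NV of NVis(W) attached to both Vis(w) and Vis(v), and a window e of Vis(v) with e ⊆ closure(NV), such that x is visible from some point of e. -/

import Mathlib

open Set

noncomputable section

abbrev Plane := EuclideanSpace ℝ (Fin 2)

/-- A simple polygon, given by a cyclic sequence of at least three distinct vertices
whose closed polygonal boundary curve is a Jordan polygon: two edges intersect exactly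
when they are consecutive, and then only in their one shared endpoint. -/
structure SimplePolygon where
  n : ℕ
  three_le : 3 ≤ n
  vertex : ℕ → Plane
  periodic : ∀ i, vertex (i + n) = vertex i
  inj : ∀ i < n, ∀ j < n, vertex i = vertex j → i = j
  jordan : ∀ i < n, ∀ j < n, i ≠ j →
    segment ℝ (vertex i) (vertex (i + 1)) ∩ segment ℝ (vertex j) (vertex (j + 1)) =
      if j = (i + 1) % n then {vertex (i + 1)}
      else if i = (j + 1) % n then {vertex (j + 1)}
      else ∅

namespace SimplePolygon

/-- The boundary curve of the polygon: the union of its edges. -/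
def boundary (P : SimplePolygon) : Set Plane :=
  ⋃ i ∈ Finset.range P.n, segment ℝ (P.vertex i) (P.vertex (i + 1))

/-- The polygon as a region: the boundary together with all bounded connected
components of the complement of the boundary. -/
def region (P : SimplePolygon) : Set Plane :=
  P.boundary ∪ {x | x ∉ P.boundary ∧
    Bornology.IsBounded (connectedComponentIn P.boundaryᶜ x)}

/-- Visibility region of a point `p`: all points `q` of the polygon such that the
closed segment `[p,q]` is contained in the polygon. -/
def Vis (P : SimplePolygon) (p : Plane) : Set Plane :=
  {q | q ∈ P.region ∧ segment ℝ p q ⊆ P.region}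

/-- Visibility region of a set. -/
def VisSet (P : SimplePolygon) (S : Set Plane) : Set Plane :=
  ⋃ p ∈ S, P.Vis p

/-- Two points of the polygon are visible to each other if the segment joining them
lies in the polygon. -/
def Visible (P : SimplePolygon) (p q : Plane) : Prop :=
  p ∈ P.region ∧ q ∈ P.region ∧ segment ℝ p q ⊆ P.region

/-- A witness set: a finite set of points of the polygon with pairwise disjoint
visibility regions. -/
def IsWitnessSet (P : SimplePolygon) (W : Set Plane) : Prop :=
  W.Finite ∧ W ⊆ P.region ∧
    ∀ x ∈ W, ∀ y ∈ W, x ≠ y → P.Vis x ∩ P.Vis y = ∅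

/-- The non-visible region of a witness set. -/
def NVis (P : SimplePolygon) (W : Set Plane) : Set Plane :=
  P.region \ ⋃ w ∈ W, P.Vis w

/-- `Vis p` is regular (has no arms) if it equals the closure of its interior. -/
def VisRegular (P : SimplePolygon) (p : Plane) : Prop :=
  P.Vis p = closure (interior (P.Vis p))

/-- A window of `Vis p`: a non-degenerate closed segment contained in the frontier of
`Vis p` whose intersection with the frontier of the polygon is exactly its two
endpoints, maximal with these properties. -/
def IsWindow (P : SimplePolygon) (p : Plane) (e : Set Plane) : Prop :=
  ∃ a b : Plane, a ≠ b ∧ e = segment ℝ a b ∧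
    e ⊆ frontier (P.Vis p) ∧
    e ∩ frontier P.region = {a, b} ∧
    ∀ a' b' : Plane, a' ≠ b' →
      segment ℝ a' b' ⊆ frontier (P.Vis p) →
      segment ℝ a' b' ∩ frontier P.region = {a', b'} →
      e ⊆ segment ℝ a' b' → e = segment ℝ a' b'

/-- `γ` is (the image of) a neighbor witness path between `w` and `w'`. -/
def IsNWPath (P : SimplePolygon) (W : Set Plane) (w w' : Plane) (γ : Set Plane) : Prop :=
  ∃ f : Path w w', γ = Set.range f ∧ γ ⊆ P.Vis w ∪ P.NVis W ∪ P.Vis w'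

/-- Adjacency in the neighbor witness graph `GCon(W)`. -/
def GConAdj (P : SimplePolygon) (W : Set Plane) (w w' : Plane) : Prop :=
  w ∈ W ∧ w' ∈ W ∧ w ≠ w' ∧ ∃ γ : Set Plane, P.IsNWPath W w w' γ

/-- A connected component `NV` of `NVis W` is attached to `Vis w` if the closure of
`NV` intersects `Vis w`. -/
def Attached (P : SimplePolygon) (NV : Set Plane) (w : Plane) : Prop :=
  (closure NV ∩ P.Vis w).Nonempty

/-- `w` is a simplicial vertex of `GCon(W)`: its neighbors are pairwise adjacent. -/
def Simplicial (P : SimplePolygon) (W : Set Plane) (w : Plane) : Prop :=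
  ∀ u v : Plane, P.GConAdj W w u → P.GConAdj W w v → u ≠ v → P.GConAdj W u v

end SimplePolygon

/-- `NV` is a connected component of `S`. -/
def IsCompOf (NV S : Set Plane) : Prop :=
  ∃ x ∈ S, NV = connectedComponentIn S x

open Topology

/-- Near every point `p`, membership in `R` is invariant under shrinking towards `p`. -/
def LocallyConic {E : Type*} [AddCommGroup E] [Module ℝ E] [TopologicalSpace E]
    (R : Set E) : Prop :=
  ∀ p, ∀ᶠ q in 𝓝 p, ∀ l ∈ Ioc (0 : ℝ) 1, (AffineMap.lineMap p q l ∈ R ↔ q ∈ R)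

/-- Near every point `p`, the set `B` is contained in the union of two rays from `p`. -/
def LocallyTwoRays {E : Type*} [AddCommGroup E] [Module ℝ E] [TopologicalSpace E]
    (B : Set E) : Prop :=
  ∀ p, ∃ c d : E, ∀ᶠ q in 𝓝 p, q ∈ B →
    ∃ s : ℝ, 0 ≤ s ∧ (q = AffineMap.lineMap p c s ∨ q = AffineMap.lineMap p d s)

/-- The points that see `p` inside `R`. -/
def starAt {E : Type*} [AddCommGroup E] [Module ℝ E] (R : Set E) (p : E) : Set E :=
  {q | segment ℝ p q ⊆ R}

theorem IsClosed.starAt {E : Type*} [AddCommGroup E] [Module ℝ E] [TopologicalSpace E]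
    [ContinuousAdd E] [ContinuousSMul ℝ E] {R : Set E} (hR : IsClosed R) (p : E) :
    IsClosed (starAt R p) := by
  have : _root_.starAt R p = ⋂ ab ∈ {ab : ℝ × ℝ | 0 ≤ ab.1 ∧ 0 ≤ ab.2 ∧ ab.1 + ab.2 = 1},
      (fun q : E => ab.1 • p + ab.2 • q) ⁻¹' R := by
    ext q
    simp only [_root_.starAt, mem_ofPred_eq, mem_iInter, mem_preimage, Prod.forall]
    constructor
    · rintro h a b ⟨ha, hb, hab⟩
      exact h ⟨a, b, ha, hb, hab, rfl⟩
    · rintro h _ ⟨a, b, ha, hb, hab, rfl⟩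
      exact h a b ⟨ha, hb, hab⟩
  rw [this]
  exact isClosed_biInter fun ab _ => hR.preimage (by fun_prop)

theorem IsPreconnected.subset_of_disjoint_frontier {X : Type*} [TopologicalSpace X]
    {R S : Set X} (hS : IsPreconnected S) (hR : IsClosed R)
    (hd : ∀ q ∈ S, q ∉ frontier R) {p : X} (hpS : p ∈ S) (hpR : p ∈ R) : S ⊆ R := by
  rw [hR.frontier_eq] at hd
  refine (hS.subset_left_of_subset_union isOpen_interior hR.isOpen_compl ?_ ?_ ?_).trans
    interior_subset
  · exact disjoint_compl_right.mono_left interior_subset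
  · intro q hq
    by_cases h : q ∈ R
    · left
      by_contra h'
      exact hd q hq ⟨h, h'⟩
    · exact Or.inr h
  · refine ⟨p, hpS, ?_⟩
    by_contra h'
    exact hd p hpS ⟨hpR, h'⟩

theorem lineMap_eq_mk (p q : ℝ × ℝ) (l : ℝ) :
    AffineMap.lineMap p q l = (p.1 + l * (q.1 - p.1), p.2 + l * (q.2 - p.2)) := by
  ext <;> simp [AffineMap.lineMap_apply] <;> ring

theorem exists_mem_snd_ne_zero {O : Set (ℝ × ℝ)} (hO : IsOpen O) (hne : O.Nonempty) :
    ∃ m ∈ O, m.2 ≠ 0 := by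
  obtain ⟨m, hm⟩ := hne
  have h1 : ∀ᶠ s in 𝓝 m.2, (m.1, s) ∈ O :=
    (Continuous.prodMk_right m.1).continuousAt.eventually (hO.mem_nhds hm)
  obtain ⟨s, hs, hs0⟩ := ((h1.filter_mono nhdsWithin_le_nhds).and
    (show ∀ᶠ s in 𝓝[≠] m.2, s ≠ 0 from by
      by_cases h0 : m.2 = 0
      · rw [h0]; exact eventually_mem_nhdsWithin
      · exact (isOpen_ne.mem_nhds h0 |> fun h => mem_nhdsWithin_of_mem_nhds h))).exists
  exact ⟨_, hs, hs0⟩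

theorem notMem_starAt_of_ray {R : Set (ℝ × ℝ)} {a : ℝ} (ha : 0 < a) {q : ℝ × ℝ}
    (hq : ∀ l ∈ Ioc (0 : ℝ) 1, AffineMap.lineMap (a, (0 : ℝ)) q l ∉ R)
    {m : ℝ × ℝ} {k : ℝ} (hk : k ∈ Ioc (0 : ℝ) 1) (hm2 : m.2 = k * q.2)
    (hm1 : k * (q.1 - a) < m.1 - a) : m ∉ starAt R 0 := by
  intro hm
  set D := m.1 - k * (q.1 - a) with hD
  have hDa : a < D := by linarith
  have hD0 : 0 < D := ha.trans hDa
  have hμ1 : a / D ≤ 1 := (div_le_one hD0).2 hDa.le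
  have hμ0 : 0 < a / D := by positivity
  refine hq (a / D * k) ⟨mul_pos hμ0 hk.1, mul_le_one₀ hμ1 hk.1.le hk.2⟩ ?_
  have : (a / D) • m ∈ R := by
    apply hm
    exact ⟨1 - a / D, a / D, by linarith, hμ0.le, by ring, by simp⟩
  convert this using 1
  rw [lineMap_eq_mk]
  ext
  · simp only [Prod.smul_fst, smul_eq_mul]
    have : m.1 = D + k * (q.1 - a) := by rw [hD]; ring
    rw [this]; field_simp
  · simp only [Prod.smul_snd, smul_eq_mul, hm2]; ring

theorem eventually_notMem_starAt {R : Set (ℝ × ℝ)} {a : ℝ} (ha : 0 < a) {q : ℝ × ℝ}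
    (hq : ∀ l ∈ Ioc (0 : ℝ) 1, AffineMap.lineMap (a, (0 : ℝ)) q l ∉ R) {t : ℝ}
    (hat : a < t) : ∀ᶠ m in 𝓝 (t, (0 : ℝ)), 0 < m.2 / q.2 → m ∉ starAt R 0 := by
  have c1 : ContinuousAt (fun m : ℝ × ℝ => m.2 / q.2) (t, 0) := by fun_prop
  have c2 : ContinuousAt (fun m : ℝ × ℝ => m.1 - a - m.2 / q.2 * (q.1 - a)) (t, 0) := by fun_prop
  have e1 := c1.eventually_lt_const (u := 1) (by simp)
  have e2 := c2.eventually_const_lt (u := 0) (by simpa using hat)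
  filter_upwards [e1, e2] with m h1 h2 h3
  refine notMem_starAt_of_ray ha hq (k := m.2 / q.2) ⟨h3, h1.le⟩ ?_ (by linarith)
  have : q.2 ≠ 0 := by rintro h; simp [h] at h3
  field_simp

theorem exists_ray_compl {E : Type*} [AddCommGroup E] [Module ℝ E] [TopologicalSpace E]
    {R S : Set E} (hcone : LocallyConic R) {p : E} {U : Set E} (hU : U ∈ 𝓝 p)
    (h : p ∈ closure (Rᶜ ∩ S)) :
    ∃ q ∈ S, q ∈ U ∧ ∀ l ∈ Ioc (0 : ℝ) 1, AffineMap.lineMap p q l ∉ R := by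
  obtain ⟨q, hq, hqR, hqS⟩ := mem_closure_iff_nhds.1 h _ (Filter.inter_mem (hcone p) hU)
  exact ⟨q, hqS, hq.2, fun l hl hm => hqR ((hq.1 l hl).1 hm)⟩

/-- A thin box over a compact interval of the first axis. -/
theorem exists_box {a b : ℝ} {N : ℝ × ℝ → Prop}
    (h : ∀ t ∈ Icc a b, ∀ᶠ m in 𝓝 (t, (0 : ℝ)), N m) :
    ∃ ε > 0, ∀ t ∈ Icc a b, ∀ s : ℝ, |s| < ε → N (t, s) := by
  obtain ⟨u, v, -, hv, hu, h0, huv⟩ := generalized_tube_lemma (isCompact_Icc (a := a) (b := b))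
    (isCompact_singleton (x := (0 : ℝ))) (n := interior {m | N m}) isOpen_interior
    (by rintro ⟨t, s⟩ ⟨ht, rfl : s = 0⟩; exact mem_interior_iff_mem_nhds.2 (h t ht))
  obtain ⟨ε, hε, hεv⟩ := Metric.isOpen_iff.1 hv 0 (h0 rfl)
  refine ⟨ε, hε, fun t ht s hs => ?_⟩
  have : (t, s) ∈ u ×ˢ v := ⟨hu ht, hεv (by simpa [Real.dist_eq] using hs)⟩
  exact interior_subset (huv this)

theorem exists_preconnected_box {N : Set (ℝ × ℝ)} {a b t : ℝ} (h1 : (1 : ℝ) ∈ Icc a b)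
    (ht : t ∈ Icc a b)
    (h : ∀ τ ∈ Icc a b, ∀ᶠ m in 𝓝 (τ, (0 : ℝ)), 0 < m.2 → m.1 ∈ Icc a b → m ∈ N) :
    ∃ G ⊆ N, IsPreconnected G ∧ (∃ s ∈ Ioc (0 : ℝ) 1, (1, s) ∈ G) ∧
      (t, (0 : ℝ)) ∈ closure G := by
  obtain ⟨ε, hε, hbox⟩ := exists_box h
  refine ⟨Icc a b ×ˢ Ioo 0 ε, ?_, ?_, ⟨min 1 (ε / 2), ?_, ?_⟩, ?_⟩
  · rintro ⟨u, s⟩ ⟨hu, hs⟩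
    exact hbox u hu s (by rw [abs_of_pos hs.1]; exact hs.2) hs.1 hu
  · exact ((convex_Icc a b).prod (convex_Ioo 0 ε)).isPreconnected
  · exact ⟨lt_min one_pos (by positivity), min_le_left _ _⟩
  · exact ⟨h1, lt_min one_pos (by positivity), (min_le_right _ _).trans_lt (by linarith)⟩
  · rw [closure_prod_eq, closure_Ioo hε.ne]
    exact ⟨subset_closure ht, le_rfl, hε.le⟩

theorem exists_first_frontier {R : Set (ℝ × ℝ)} (hR : IsClosed R) (hb : Bornology.IsBounded R)
    {τ : ℝ} (hτ : (τ, (0 : ℝ)) ∈ R) :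
    ∃ b ≥ τ, (b, (0 : ℝ)) ∈ frontier R ∧ ∀ t ∈ Ico τ b, (t, (0 : ℝ)) ∈ interior R := by
  have hcont : Continuous fun t : ℝ => (t, (0 : ℝ)) := by fun_prop
  have key : ∀ t ≥ τ, (∀ u ∈ Icc τ t, (u, (0 : ℝ)) ∉ frontier R) → (t, (0 : ℝ)) ∈ R := by
    intro t ht h
    refine IsPreconnected.subset_of_disjoint_frontier (S := (fun t : ℝ => (t, (0 : ℝ))) '' Icc τ t)
      (isPreconnected_Icc.image _ hcont.continuousOn) hR ?_ ⟨τ, ⟨le_rfl, ht⟩, rfl⟩ hτ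
      ⟨t, ⟨ht, le_rfl⟩, rfl⟩
    rintro _ ⟨u, hu, rfl⟩
    exact h u hu
  obtain ⟨C, hC⟩ := hb.exists_norm_le
  set T := max τ (C + 1)
  have hT : (T, (0 : ℝ)) ∉ R := by
    intro h
    have h2 := hC _ h
    have : |T| ≤ ‖(T, (0 : ℝ))‖ := norm_fst_le (T, (0 : ℝ))
    have h3 := le_abs_self T
    have h4 : C + 1 ≤ T := le_max_right _ _
    linarith
  have hne : ({t | (t, (0 : ℝ)) ∈ frontier R} ∩ Icc τ T).Nonempty := by
    by_contra h
    rw [not_nonempty_iff_eq_empty] at h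
    refine hT (key T (le_max_left _ _) fun u hu hf => ?_)
    have : u ∈ ({t | (t, (0 : ℝ)) ∈ frontier R} ∩ Icc τ T) := ⟨hf, hu⟩
    simp [h] at this
  have hcpt : IsCompact ({t | (t, (0 : ℝ)) ∈ frontier R} ∩ Icc τ T) :=
    isCompact_Icc.inter_left (isClosed_frontier.preimage hcont)
  obtain ⟨b, ⟨hbf, hbI⟩, hmin⟩ := hcpt.exists_isLeast hne
  have hlt : ∀ t ∈ Ico τ b, (t, (0 : ℝ)) ∉ frontier R := fun t ht hf =>
    absurd (hmin ⟨hf, ht.1, ht.2.le.trans hbI.2⟩) (not_le.2 ht.2)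
  refine ⟨b, hbI.1, hbf, fun t ht => ?_⟩
  have hm := key t ht.1 fun u hu => hlt u ⟨hu.1, hu.2.trans_lt ht.2⟩
  have := hlt t ht
  rw [hR.frontier_eq] at this
  by_contra h
  exact this ⟨hm, h⟩

theorem exists_last_obstacle {R : Set (ℝ × ℝ)} (hcone : LocallyConic R)
    (hz : (1, (0 : ℝ)) ∈ starAt R 0)
    (hs : ∀ s ∈ Ioc (0 : ℝ) 1, (1, s) ∈ R \ starAt R 0) :
    ∃ a ∈ Ioc (0 : ℝ) 1, ((a, (0 : ℝ)) ∈ closure (Rᶜ ∩ {m | m.1 < 1 ∧ 0 < m.2})) ∧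
      ∀ t ∈ Ioc a 1, (t, (0 : ℝ)) ∉ closure (Rᶜ ∩ {m | m.1 < 1 ∧ 0 < m.2}) := by
  set Q := Rᶜ ∩ {m : ℝ × ℝ | m.1 < 1 ∧ 0 < m.2} with hQ
  obtain ⟨δ, hδ, hU⟩ := Metric.eventually_nhds_iff_ball.1 (hcone 0)
  obtain ⟨ρ, hρ0, hρ1⟩ : ∃ ρ, 0 < ρ ∧ ρ < min 1 δ := exists_between (lt_min one_pos hδ)
  have hρ1' : ρ < 1 := hρ1.trans_le (min_le_left _ _)
  have hρδ : ρ < δ := hρ1.trans_le (min_le_right _ _)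
  have hcont : Continuous fun t : ℝ => (t, (0 : ℝ)) := by fun_prop
  have hne : ({t | (t, (0 : ℝ)) ∈ closure Q} ∩ Icc ρ 1).Nonempty := by
    by_contra hemp
    have hO : ∀ t ∈ Icc ρ 1, ∀ᶠ m in 𝓝 (t, (0 : ℝ)), m ∉ Q := fun t ht => by
      have : (t, (0 : ℝ)) ∉ closure Q := fun h => hemp ⟨t, h, ht⟩
      filter_upwards [isClosed_closure.isOpen_compl.mem_nhds this] with m hm hmQ
      exact hm (subset_closure hmQ)
    obtain ⟨ε, hε, hbox⟩ := exists_box hO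
    set s := min 1 (ε / 2)
    have hs0 : 0 < s := lt_min one_pos (by positivity)
    have hs1 : s ≤ 1 := min_le_left _ _
    have hsε : s < ε := (min_le_right _ _).trans_lt (by linarith)
    have hR : ∀ μ ∈ Ico ρ 1, (μ, μ * s) ∈ R := by
      intro μ hμ
      have hμ0 : 0 < μ := hρ0.trans_le hμ.1
      by_contra h
      refine hbox μ ⟨hμ.1, hμ.2.le⟩ (μ * s) ?_ ⟨h, hμ.2, mul_pos hμ0 hs0⟩
      rw [abs_of_pos (mul_pos hμ0 hs0)]
      nlinarith [hμ.2]
    refine (hs s ⟨hs0, hs1⟩).2 ?_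
    rintro _ ⟨c, μ, hc, hμ, hcμ, rfl⟩
    have e : c • (0 : ℝ × ℝ) + μ • ((1 : ℝ), s) = (μ, μ * s) := by simp
    rw [e]
    rcases hμ.eq_or_lt with rfl | hμ0
    · have := hz (left_mem_segment ℝ _ _)
      convert this using 1
      simp
    rcases lt_or_ge μ ρ with h | h
    · have hb : (ρ, ρ * s) ∈ Metric.ball (0 : ℝ × ℝ) δ := by
        rw [mem_ball_zero_iff, Prod.norm_def, max_lt_iff, Real.norm_eq_abs, Real.norm_eq_abs,
          abs_of_pos hρ0, abs_of_pos (mul_pos hρ0 hs0)]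
        exact ⟨hρδ, (mul_le_of_le_one_right hρ0.le hs1).trans_lt hρδ⟩
      have := (hU _ hb (μ / ρ) ⟨by positivity, (div_le_one hρ0).2 h.le⟩).2 (hR ρ ⟨le_rfl, hρ1'⟩)
      rw [lineMap_eq_mk] at this
      convert this using 2
      · simp; field_simp
      · simp; field_simp
    rcases (show μ ≤ 1 by linarith).eq_or_lt with rfl | h1
    · simpa using (hs s ⟨hs0, hs1⟩).1
    · exact hR μ ⟨h, h1⟩
  have hcpt : IsCompact ({t | (t, (0 : ℝ)) ∈ closure Q} ∩ Icc ρ 1) :=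
    isCompact_Icc.inter_left (isClosed_closure.preimage hcont)
  obtain ⟨a, ⟨haQ, haI⟩, hmax⟩ := hcpt.exists_isGreatest hne
  exact ⟨a, ⟨hρ0.trans_le haI.1, haI.2⟩, haQ, fun t ht h =>
    absurd (hmax ⟨h, haI.1.trans ht.1.le, ht.2⟩) (not_le.2 ht.1)⟩

/-- Beyond obstacles on both sides of the axis, no point is a limit of interior visible points. -/
theorem notMem_closure_interior_starAt {R : Set (ℝ × ℝ)} {a a' t : ℝ} {q q' : ℝ × ℝ}
    (ha : 0 < a) (ha' : 0 < a') (hat : a < t) (hat' : a' < t) (hq2 : 0 < q.2) (hq2' : q'.2 < 0)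
    (hq : ∀ l ∈ Ioc (0 : ℝ) 1, AffineMap.lineMap (a, (0 : ℝ)) q l ∉ R)
    (hq' : ∀ l ∈ Ioc (0 : ℝ) 1, AffineMap.lineMap (a', (0 : ℝ)) q' l ∉ R) :
    (t, (0 : ℝ)) ∉ closure (interior (starAt R 0)) := by
  intro h
  have e1 := eventually_notMem_starAt ha hq hat
  have e2 := eventually_notMem_starAt ha' hq' hat'
  obtain ⟨U, hU, hUo, htU⟩ := eventually_nhds_iff.1 (e1.and e2)
  have hne : (U ∩ interior (starAt R 0)).Nonempty := mem_closure_iff.1 h U hUo htU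
  obtain ⟨m, ⟨hmU, hmI⟩, hm⟩ := exists_mem_snd_ne_zero (hUo.inter isOpen_interior) hne
  rcases lt_or_gt_of_ne hm with h0 | h0
  · exact (hU m hmU).2 (div_pos_of_neg_of_neg h0 hq2') (interior_subset hmI)
  · exact (hU m hmU).1 (div_pos h0 hq2) (interior_subset hmI)

theorem mem_interior_of_notMem_closure {R : Set (ℝ × ℝ)} (hcone : LocallyConic R)
    (hreg : starAt R 0 ⊆ closure (interior (starAt R 0)))
    (hz : (1, (0 : ℝ)) ∈ starAt R 0) {a : ℝ} (ha : 0 < a)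
    (haQ : (a, (0 : ℝ)) ∈ closure (Rᶜ ∩ {m | m.1 < 1 ∧ 0 < m.2}))
    (hR : IsClosed R) {t : ℝ} (ht : t ∈ Ioo a 1)
    (htQ : (t, (0 : ℝ)) ∉ closure (Rᶜ ∩ {m | m.1 < 1 ∧ 0 < m.2})) :
    (t, (0 : ℝ)) ∈ interior R := by
  by_contra hint
  have hcl : (t, (0 : ℝ)) ∈ closure (Rᶜ ∩ {m : ℝ × ℝ | m.2 < 0}) := by
    rw [← mem_compl_iff, ← closure_compl] at hint
    rw [mem_closure_iff] at hint ⊢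
    intro o ho hto
    have h1 : IsOpen {m : ℝ × ℝ | m.1 < 1} := isOpen_lt continuous_fst continuous_const
    have h2 := isClosed_closure.isOpen_compl.mem_nhds htQ
    obtain ⟨m, ⟨⟨⟨hmo, hm1⟩, hmQ⟩, hmR⟩, hm0⟩ := exists_mem_snd_ne_zero
      (((ho.inter h1).inter isClosed_closure.isOpen_compl).inter hR.isOpen_compl)
      (hint _ ((ho.inter h1).inter isClosed_closure.isOpen_compl) ⟨⟨hto, ht.2⟩, htQ⟩)
    refine ⟨m, hmo, hmR, ?_⟩
    by_contra h
    exact hmQ (subset_closure ⟨hmR, hm1, lt_of_le_of_ne (not_lt.1 h) hm0.symm⟩)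
  obtain ⟨q, hq2, -, hq⟩ := exists_ray_compl hcone Filter.univ_mem haQ
  obtain ⟨q', hq2', -, hq'⟩ := exists_ray_compl hcone Filter.univ_mem hcl
  exact notMem_closure_interior_starAt ha (ha.trans ht.1) (ht.1.trans ht.2) ht.2 hq2.2 hq2'
    hq hq' (hreg hz)

theorem convex_pos_of_affine {E : Type*} [AddCommGroup E] [Module ℝ E] {f : E → ℝ}
    (h : ∀ x y : E, ∀ a b : ℝ, a + b = 1 → f (a • x + b • y) = a * f x + b * f y) :
    Convex ℝ {m | 0 < f m} := by
  intro x hx y hy a b ha hb hab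
  have hx' : 0 < f x := hx
  have hy' : 0 < f y := hy
  show 0 < f (a • x + b • y)
  rw [h x y a b hab]
  rcases ha.eq_or_lt with rfl | ha
  · rw [show b = 1 by linarith]; linarith
  · positivity

/-- At a tip of an obstacle inside a closed quadrant, the polygon contains the complement of
that quadrant. -/
theorem eventually_mem_of_tip {R : Set (ℝ × ℝ)} (hR : IsClosed R) (hcone : LocallyConic R)
    (htwo : LocallyTwoRays (frontier R))
    (hreg : starAt R 0 ⊆ closure (interior (starAt R 0)))
    (hz : (1, (0 : ℝ)) ∈ starAt R 0)
    (hs : ∀ s ∈ Ioc (0 : ℝ) 1, (1, s) ∈ R)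
    (hQ : (1, (0 : ℝ)) ∈ closure (Rᶜ ∩ {m | m.1 < 1 ∧ 0 < m.2})) :
    ∀ᶠ m in 𝓝 (1, (0 : ℝ)), 1 < m.1 → m ∈ R := by
  obtain ⟨c, d, hcd⟩ := htwo (1, 0)
  obtain ⟨r, hr, hball⟩ := Metric.eventually_nhds_iff_ball.1 hcd
  set U := Metric.ball ((1 : ℝ), (0 : ℝ)) r with hUdef
  have hUc : Convex ℝ U := convex_ball _ _
  have hUo : IsOpen U := Metric.isOpen_ball
  have hUn : U ∈ 𝓝 (1, (0 : ℝ)) := Metric.ball_mem_nhds _ hr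
  have hmemU : ∀ m : ℝ × ℝ, m ∈ U ↔ |m.1 - 1| < r ∧ |m.2| < r := by
    intro m
    rw [hUdef, Metric.mem_ball, Prod.dist_eq, max_lt_iff, Real.dist_eq, Real.dist_eq, sub_zero]
  obtain ⟨q, ⟨hq1, hq2⟩, hqU, hq⟩ := exists_ray_compl hcone hUn hQ
  have hqR : q ∉ R := by simpa using hq 1 ⟨one_pos, le_rfl⟩
  -- frontier points on segments towards `q`
  have hfr : ∀ p ∈ U, p ∈ R → ∃ θ ∈ Ico (0 : ℝ) 1,
      ∃ p' ∈ frontier R, p' ∈ U ∧ p' = (p.1 + θ * (q.1 - p.1), p.2 + θ * (q.2 - p.2)) := by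
    intro p hpU hpR
    by_contra hno
    push Not at hno
    refine hqR (IsPreconnected.subset_of_disjoint_frontier (convex_segment p q).isPreconnected hR
      ?_ (left_mem_segment ℝ p q) hpR (right_mem_segment ℝ p q))
    intro m hm hmf
    have hmU := hUc.segment_subset hpU hqU hm
    rw [segment_eq_image_lineMap] at hm
    obtain ⟨θ, hθ, rfl⟩ := hm
    rcases hθ.2.eq_or_lt with rfl | h1
    · rw [AffineMap.lineMap_apply_one] at hmf
      exact hqR (hR.frontier_subset hmf)
    · exact hno θ ⟨hθ.1, h1⟩ _ hmf hmU (lineMap_eq_mk p q θ)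
  obtain ⟨δ, hδ0, hδ⟩ : ∃ δ, 0 < δ ∧ δ < min 1 r := exists_between (lt_min one_pos hr)
  have hδ1 : δ < 1 := hδ.trans_le (min_le_left _ _)
  have hδr : δ < r := hδ.trans_le (min_le_right _ _)
  obtain ⟨θ₁, hθ₁, p₁, hp₁f, hp₁U, hp₁⟩ := hfr (1 - δ, 0)
    ((hmemU _).2 ⟨by simpa [abs_of_pos hδ0] using hδr, by simpa using hr⟩)
    (hz ⟨δ, 1 - δ, hδ0.le, by linarith, by ring, by simp⟩)
  obtain ⟨θ₂, hθ₂, p₂, hp₂f, hp₂U, hp₂⟩ := hfr (1, δ)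
    ((hmemU _).2 ⟨by simpa using hr, by simpa [abs_of_pos hδ0] using hδr⟩)
    (hs δ ⟨hδ0, hδ1.le⟩)
  -- relative coordinates
  obtain ⟨x₁, hx₁⟩ : ∃ x, x = 1 - p₁.1 := ⟨_, rfl⟩
  obtain ⟨x₂, hx₂⟩ : ∃ x, x = 1 - p₂.1 := ⟨_, rfl⟩
  obtain ⟨y₁, hy₁⟩ : ∃ x, x = p₁.2 := ⟨_, rfl⟩
  obtain ⟨y₂, hy₂⟩ : ∃ x, x = p₂.2 := ⟨_, rfl⟩
  obtain ⟨u, hu⟩ : ∃ u, u = 1 - q.1 := ⟨_, rfl⟩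
  have hu0 : 0 < u := by linarith
  have ex₁ : x₁ = δ * (1 - θ₁) + θ₁ * u := by rw [hx₁, hp₁, hu]; ring
  have ey₁ : y₁ = θ₁ * q.2 := by rw [hy₁, hp₁]; ring
  have ex₂ : x₂ = θ₂ * u := by rw [hx₂, hp₂, hu]; ring
  have ey₂ : y₂ = δ * (1 - θ₂) + θ₂ * q.2 := by rw [hy₂, hp₂]; ring
  have h1θ₁ : 0 < 1 - θ₁ := by linarith [hθ₁.2]
  have h1θ₂ : 0 < 1 - θ₂ := by linarith [hθ₂.2]
  have hθ₁0 := hθ₁.1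
  have hθ₂0 := hθ₂.1
  have hx₁0 : 0 < x₁ := by rw [ex₁]; positivity
  have hy₁0 : 0 ≤ y₁ := by rw [ey₁]; positivity
  have hx₂0 : 0 ≤ x₂ := by rw [ex₂]; positivity
  have hy₂0 : 0 < y₂ := by rw [ey₂]; positivity
  have hq₁ : 0 < x₁ * q.2 - y₁ * u := by
    rw [ex₁, ey₁]
    have : 0 < δ * (1 - θ₁) * q.2 := by positivity
    linarith
  have hq₂ : 0 < y₂ * u - x₂ * q.2 := by
    rw [ex₂, ey₂]
    have : 0 < δ * (1 - θ₂) * u := by positivity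
    linarith
  have hΔ : 0 < x₁ * y₂ - y₁ * x₂ := by
    have h : (x₁ * y₂ - y₁ * x₂) * q.2 = y₂ * (x₁ * q.2 - y₁ * u) + y₁ * (y₂ * u - x₂ * q.2) := by
      ring
    have h' : 0 < y₂ * (x₁ * q.2 - y₁ * u) + y₁ * (y₂ * u - x₂ * q.2) := by positivity
    rw [← h] at h'
    exact pos_of_mul_pos_left h' hq2.le
  -- linear functionals vanishing on the two boundary rays
  set f : ℝ × ℝ → ℝ := fun m => (m.1 - 1) * y₂ + x₂ * m.2 with hf
  set g : ℝ × ℝ → ℝ := fun m => -((m.1 - 1) * y₁ + x₁ * m.2) with hg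
  have hrays : ∀ m ∈ U, m ∈ frontier R → (f m = 0 ∧ g m ≤ 0) ∨ (g m = 0 ∧ f m ≤ 0) := by
    intro m hmU hmf
    have hA : ∀ (e m : ℝ × ℝ) (s₁ s : ℝ), 0 ≤ s₁ → 0 ≤ s →
        p₁ = AffineMap.lineMap ((1 : ℝ), (0 : ℝ)) e s₁ →
        m = AffineMap.lineMap ((1 : ℝ), (0 : ℝ)) e s → g m = 0 ∧ f m ≤ 0 := by
      intro e m s₁ s hs₁ hs h₁ h
      simp only [lineMap_eq_mk, Prod.ext_iff] at h₁ h
      have hX : s₁ * (m.1 - 1) = -(s * x₁) := by rw [h.1, hx₁, h₁.1]; ring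
      have hY : s₁ * m.2 = s * y₁ := by rw [h.2, hy₁, h₁.2]; ring
      have hpos : 0 < s₁ := by
        refine lt_of_le_of_ne hs₁ ?_
        rintro rfl
        have := h₁.1
        linarith
      constructor
      · have : s₁ * g m = 0 := by simp only [hg]; linear_combination -y₁ * hX - x₁ * hY
        exact (mul_eq_zero.1 this).resolve_left hpos.ne'
      · have h3 : s₁ * f m = -(s * (x₁ * y₂ - y₁ * x₂)) := by
          simp only [hf]; linear_combination y₂ * hX + x₂ * hY
        have h4 : 0 ≤ s * (x₁ * y₂ - y₁ * x₂) := by positivity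
        by_contra h5
        have : 0 < s₁ * f m := mul_pos hpos (not_le.1 h5)
        linarith
    have hB : ∀ (e m : ℝ × ℝ) (s₂ s : ℝ), 0 ≤ s₂ → 0 ≤ s →
        p₂ = AffineMap.lineMap ((1 : ℝ), (0 : ℝ)) e s₂ →
        m = AffineMap.lineMap ((1 : ℝ), (0 : ℝ)) e s → f m = 0 ∧ g m ≤ 0 := by
      intro e m s₂ s hs₂ hs h₂ h
      simp only [lineMap_eq_mk, Prod.ext_iff] at h₂ h
      have hX : s₂ * (m.1 - 1) = -(s * x₂) := by rw [h.1, hx₂, h₂.1]; ring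
      have hY : s₂ * m.2 = s * y₂ := by rw [h.2, hy₂, h₂.2]; ring
      have hpos : 0 < s₂ := by
        refine lt_of_le_of_ne hs₂ ?_
        rintro rfl
        have := h₂.2
        linarith
      constructor
      · have : s₂ * f m = 0 := by simp only [hf]; linear_combination y₂ * hX + x₂ * hY
        exact (mul_eq_zero.1 this).resolve_left hpos.ne'
      · have h3 : s₂ * g m = -(s * (x₁ * y₂ - y₁ * x₂)) := by
          simp only [hg]; linear_combination -y₁ * hX - x₁ * hY
        have h4 : 0 ≤ s * (x₁ * y₂ - y₁ * x₂) := by positivity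
        by_contra h5
        have : 0 < s₂ * g m := mul_pos hpos (not_le.1 h5)
        linarith
    have hgp₂ : g p₂ ≠ 0 := by
      have : g p₂ = -(x₁ * y₂ - y₁ * x₂) := by
        simp only [hg]; rw [← hy₂, show p₂.1 = 1 - x₂ by linarith]; ring
      rw [this]
      exact (neg_neg_of_pos hΔ).ne
    obtain ⟨s₁, hs₁, h₁⟩ := hball _ hp₁U hp₁f
    obtain ⟨s₂, hs₂, h₂⟩ := hball _ hp₂U hp₂f
    obtain ⟨s, hs, h⟩ := hball m hmU hmf
    rcases h₁ with h₁ | h₁ <;> rcases h₂ with h₂ | h₂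
    · exact absurd (hA _ _ _ _ hs₁ hs₂ h₁ h₂).1 hgp₂
    · rcases h with h | h
      · exact Or.inr (hA _ _ _ _ hs₁ hs h₁ h)
      · exact Or.inl (hB _ _ _ _ hs₂ hs h₂ h)
    · rcases h with h | h
      · exact Or.inl (hB _ _ _ _ hs₂ hs h₂ h)
      · exact Or.inr (hA _ _ _ _ hs₁ hs h₁ h)
    · exact absurd (hA _ _ _ _ hs₁ hs₂ h₁ h₂).1 hgp₂
  have hfa : ∀ x y : ℝ × ℝ, ∀ a b : ℝ, a + b = 1 → f (a • x + b • y) = a * f x + b * f y := by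
    intro x y a b hab
    simp only [hf, Prod.fst_add, Prod.snd_add, Prod.smul_fst, Prod.smul_snd, smul_eq_mul]
    linear_combination y₂ * hab
  have hga : ∀ x y : ℝ × ℝ, ∀ a b : ℝ, a + b = 1 → g (a • x + b • y) = a * g x + b * g y := by
    intro x y a b hab
    simp only [hg, Prod.fst_add, Prod.snd_add, Prod.smul_fst, Prod.smul_snd, smul_eq_mul]
    linear_combination -y₁ * hab
  have hfC : Convex ℝ {m | 0 < f m} := convex_pos_of_affine hfa
  have hgC : Convex ℝ {m | 0 < g m} := convex_pos_of_affine hga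
  have hfC' : Convex ℝ {m | 0 < -f m} := convex_pos_of_affine fun x y a b hab => by
    rw [hfa x y a b hab]; ring
  have hgC' : Convex ℝ {m | 0 < -g m} := convex_pos_of_affine fun x y a b hab => by
    rw [hga x y a b hab]; ring
  -- moving away from the quadrant
  set w : ℝ × ℝ → ℝ → ℝ × ℝ := fun m τ => (m.1 + τ * (x₁ + x₂), m.2 - τ * (y₁ + y₂)) with hw
  have hwf : ∀ m τ, f (w m τ) = f m + τ * (x₁ * y₂ - y₁ * x₂) := by
    intro m τ; simp only [hf, hw]; ring
  have hwg : ∀ m τ, g (w m τ) = g m + τ * (x₁ * y₂ - y₁ * x₂) := by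
    intro m τ; simp only [hg, hw]; ring
  have hwO : ∀ O : Set (ℝ × ℝ), IsOpen O → ∀ m ∈ O, ∃ τ > 0, w m τ ∈ O := by
    intro O hO m hm
    have hc : ContinuousAt (w m) 0 := by fun_prop
    have h0 : w m 0 = m := by simp [hw]
    have := hc.eventually (by rw [h0]; exact hO.mem_nhds hm)
    obtain ⟨τ, hτ, hτ0⟩ :=
      ((this.filter_mono nhdsWithin_le_nhds).and (self_mem_nhdsWithin (s := Ioi (0 : ℝ)))).exists
    exact ⟨τ, hτ0, hτ⟩
  have hpre : IsPreconnected (U ∩ {m | 0 < f m} ∪ U ∩ {m | 0 < g m}) := by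
    refine IsPreconnected.union' ?_ (hUc.inter hfC).isPreconnected (hUc.inter hgC).isPreconnected
    obtain ⟨τ, hτ, hτU⟩ := hwO U hUo (1, 0) (mem_of_mem_nhds hUn)
    have := mul_pos hτ hΔ
    refine ⟨_, ⟨hτU, ?_⟩, hτU, ?_⟩
    · rw [mem_ofPred_eq, hwf]; simpa [hf] using this
    · rw [mem_ofPred_eq, hwg]; simpa [hg] using this
  obtain ⟨m₀, hm₀U, hm₀I⟩ := mem_closure_iff.1 (hreg hz) U hUo (mem_of_mem_nhds hUn)
  have hVR : interior (starAt R 0) ⊆ R := fun m hm =>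
    interior_subset hm (right_mem_segment ℝ _ _)
  have hstart : ∃ m ∈ U, (0 < f m ∨ 0 < g m) ∧ m ∈ R := by
    obtain ⟨τ, hτ, hτU, hτI⟩ := hwO _ (hUo.inter isOpen_interior) m₀ ⟨hm₀U, hm₀I⟩
    have h0 := mul_pos hτ hΔ
    rcases le_or_gt 0 (f m₀) with h | h
    · exact ⟨_, hτU, Or.inl (by rw [hwf]; linarith), hVR hτI⟩
    rcases le_or_gt 0 (g m₀) with h' | h'
    · exact ⟨_, hτU, Or.inr (by rw [hwg]; linarith), hVR hτI⟩
    refine absurd (IsPreconnected.subset_of_disjoint_frontier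
      ((hUc.inter hfC').inter hgC').isPreconnected hR ?_
      (⟨⟨hm₀U, neg_pos.2 h⟩, neg_pos.2 h'⟩ : m₀ ∈ U ∩ {m | 0 < -f m} ∩ {m | 0 < -g m})
      (hVR hm₀I) ⟨⟨hqU, ?_⟩, ?_⟩) hqR
    · rintro m ⟨⟨hmU, hm1⟩, hm2⟩ hmf
      rcases hrays m hmU hmf with h | h
      · exact (neg_pos.1 hm1).ne h.1
      · exact (neg_pos.1 hm2).ne h.1
    · simp only [mem_ofPred_eq, hf]
      rw [show q.1 = 1 - u by linarith]
      linarith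
    · simp only [mem_ofPred_eq, hg]
      rw [show q.1 = 1 - u by linarith]
      linarith
  have hD : ∀ m ∈ U, 0 < f m ∨ 0 < g m → m ∈ R := by
    intro m hmU hm
    obtain ⟨m₁, hm₁U, hm₁, hm₁R⟩ := hstart
    have hmem : ∀ m ∈ U, 0 < f m ∨ 0 < g m → m ∈ U ∩ {m | 0 < f m} ∪ U ∩ {m | 0 < g m} :=
      fun m hmU h => h.imp (fun h => ⟨hmU, h⟩) (fun h => ⟨hmU, h⟩)
    refine hpre.subset_of_disjoint_frontier hR ?_ (hmem m₁ hm₁U hm₁) hm₁R (hmem m hmU hm)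
    rintro p (⟨hpU, hp⟩ | ⟨hpU, hp⟩) hpf
    · have hp' : 0 < f p := hp
      rcases hrays p hpU hpf with h | h <;> linarith [h.1, h.2]
    · have hp' : 0 < g p := hp
      rcases hrays p hpU hpf with h | h <;> linarith [h.1, h.2]
  filter_upwards [hUn] with m hmU hm1
  by_contra hmR
  have h1 : ¬ 0 < f m := fun h => hmR (hD m hmU (Or.inl h))
  have h2 : ¬ 0 < g m := fun h => hmR (hD m hmU (Or.inr h))
  simp only [hf, hg] at h1 h2
  have k : (m.1 - 1) * (x₁ * y₂ - y₁ * x₂)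
      = x₁ * ((m.1 - 1) * y₂ + x₂ * m.2) + x₂ * -((m.1 - 1) * y₁ + x₁ * m.2) := by ring
  have k1 : 0 < (m.1 - 1) * (x₁ * y₂ - y₁ * x₂) := mul_pos (by linarith) hΔ
  nlinarith

theorem exists_window_planar {R C : Set (ℝ × ℝ)} (hR : IsClosed R) (hb : Bornology.IsBounded R)
    (hcone : LocallyConic R) (htwo : LocallyTwoRays (frontier R))
    (hreg : starAt R 0 ⊆ closure (interior (starAt R 0)))
    (hz : (1, (0 : ℝ)) ∈ starAt R 0)
    (hs : ∀ s ∈ Ioc (0 : ℝ) 1, (1, s) ∈ R \ (starAt R 0 ∪ C))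
    (hC : IsClosed C) (hVC : Disjoint (starAt R 0) C) :
    ∃ a b : ℝ, a < b ∧ 1 ∈ Icc a b ∧ (a, (0 : ℝ)) ∈ frontier R ∧ (b, (0 : ℝ)) ∈ frontier R ∧
      (∀ t ∈ Ioo a b, (t, (0 : ℝ)) ∈ interior R) ∧
      (∀ t ∈ Icc a b, (t, (0 : ℝ)) ∈ starAt R 0) ∧
      ∀ t ∈ Icc a b,
        (t, (0 : ℝ)) ∈ closure (connectedComponentIn (R \ (starAt R 0 ∪ C)) (1, 1)) := by
  have hsR : ∀ s ∈ Ioc (0 : ℝ) 1, (1, s) ∈ R := fun s h => (hs s h).1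
  obtain ⟨a, ⟨ha0, ha1⟩, haQ, hmax⟩ := exists_last_obstacle hcone hz fun s h =>
    ⟨(hs s h).1, fun h' => (hs s h).2 (Or.inl h')⟩
  set Q := Rᶜ ∩ {m : ℝ × ℝ | m.1 < 1 ∧ 0 < m.2} with hQdef
  have haxis : ∀ t ∈ Icc (0 : ℝ) 1, (t, (0 : ℝ)) ∈ R := fun t ht =>
    hz ⟨1 - t, t, by linarith [ht.2], ht.1, by ring, by simp⟩
  have haf : (a, (0 : ℝ)) ∈ frontier R := by
    rw [frontier_eq_closure_inter_closure]
    exact ⟨subset_closure (haxis a ⟨ha0.le, ha1⟩), closure_mono inter_subset_left haQ⟩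
  obtain ⟨q, hqQ, -, hq⟩ := exists_ray_compl hcone Filter.univ_mem haQ
  -- the other end
  obtain ⟨b, hab, h1b, hbf, hint⟩ : ∃ b, a < b ∧ 1 ≤ b ∧ (b, (0 : ℝ)) ∈ frontier R ∧
      ∀ t ∈ Ioo a b, (t, (0 : ℝ)) ∈ interior R := by
    rcases ha1.lt_or_eq with ha1 | rfl
    · obtain ⟨b, h1b, hbf, hb⟩ := exists_first_frontier hR hb (haxis 1 ⟨zero_le_one, le_rfl⟩)
      refine ⟨b, ha1.trans_le h1b, h1b, hbf, fun t ht => ?_⟩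
      rcases lt_or_ge t 1 with h | h
      · exact mem_interior_of_notMem_closure hcone hreg hz ha0 haQ hR ⟨ht.1, h⟩
          (hmax t ⟨ht.1, h.le⟩)
      · exact hb t ⟨h, ht.2⟩
    · have htip := eventually_mem_of_tip hR hcone htwo hreg hz hsR haQ
      obtain ⟨δ, hδ, hball⟩ := Metric.eventually_nhds_iff_ball.1 htip
      have hnear : ∀ t ∈ Ioo (1 : ℝ) (1 + δ), (t, (0 : ℝ)) ∈ interior R := by
        intro t ht
        rw [mem_interior]
        refine ⟨Metric.ball (1, (0 : ℝ)) δ ∩ {m | 1 < m.1}, fun m hm => hball m hm.1 hm.2,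
          Metric.isOpen_ball.inter (isOpen_lt continuous_const continuous_fst), ?_, ht.1⟩
        rw [Metric.mem_ball, Prod.dist_eq, Real.dist_eq, dist_self, max_lt_iff,
          abs_of_pos (by linarith [ht.1])]
        exact ⟨by linarith [ht.2], hδ⟩
      have hτ := hnear (1 + δ / 2) ⟨by linarith, by linarith⟩
      obtain ⟨b, h1b, hbf, hb⟩ := exists_first_frontier hR hb (interior_subset hτ)
      refine ⟨b, by linarith, by linarith, hbf, fun t ht => ?_⟩
      rcases lt_or_ge t (1 + δ / 2) with h | h
      · exact hnear t ⟨ht.1, by linarith⟩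
      · exact hb t ⟨h, ht.2⟩
  have hbR : (b, (0 : ℝ)) ∈ R := hR.frontier_subset hbf
  have hseg : ∀ t ∈ Icc 0 b, (t, (0 : ℝ)) ∈ R := by
    intro t ht
    rcases le_or_gt t 1 with h | h
    · exact haxis t ⟨ht.1, h⟩
    · rcases ht.2.lt_or_eq with h' | rfl
      · exact interior_subset (hint t ⟨ha1.trans_lt h, h'⟩)
      · exact hbR
  have hstar : ∀ t ∈ Icc 0 b, (t, (0 : ℝ)) ∈ starAt R 0 := by
    rintro t ht _ ⟨c, μ, hc, hμ, hcμ, rfl⟩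
    have : c • (0 : ℝ × ℝ) + μ • (t, (0 : ℝ)) = (μ * t, 0) := by simp
    rw [this]
    exact hseg _ ⟨mul_nonneg hμ ht.1, (mul_le_of_le_one_left ht.1 (by linarith)).trans ht.2⟩
  have hCe : ∀ t ∈ Icc 0 b, ∀ᶠ m in 𝓝 (t, (0 : ℝ)), m ∉ C := fun t ht =>
    hC.isOpen_compl.mem_nhds (hVC.notMem_of_mem_left (hstar t ht))
  have hblock : ∀ t, a < t → ∀ᶠ m in 𝓝 (t, (0 : ℝ)), 0 < m.2 → m ∉ starAt R 0 := fun t ht => by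
    filter_upwards [eventually_notMem_starAt ha0 hq ht] with m hm h
    exact hm (div_pos h hqQ.2)
  have hgen : ∀ t ∈ Ioo a b, ∀ᶠ m in 𝓝 (t, (0 : ℝ)), 0 < m.2 → m ∈ R \ (starAt R 0 ∪ C) := by
    intro t ht
    filter_upwards [hblock t ht.1, hCe t ⟨ha0.le.trans ht.1.le, ht.2.le⟩,
      mem_interior_iff_mem_nhds.1 (hint t ht)] with m h1 h2 h3 h4
    exact ⟨h3, fun h => h.elim (h1 h4) h2⟩
  have hbox : ∀ t ∈ Ioo a b, ∃ G ⊆ R \ (starAt R 0 ∪ C), IsPreconnected G ∧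
      (∃ s ∈ Ioc (0 : ℝ) 1, (1, s) ∈ G) ∧ (t, (0 : ℝ)) ∈ closure G := by
    intro t ht
    have hvert : ∀ᶠ m in 𝓝 ((1 : ℝ), (0 : ℝ)), m.2 < 1 :=
      continuousAt_snd.eventually_lt_const one_pos
    have hC1 := hCe 1 ⟨zero_le_one, h1b⟩
    rcases ha1.lt_or_eq with ha1 | rfl
    · refine exists_preconnected_box (a := min t 1) (b := max t 1)
        ⟨min_le_right _ _, le_max_right _ _⟩ ⟨min_le_left _ _, le_max_left _ _⟩ fun τ hτ => ?_
      have haτ : a < τ := (lt_min ht.1 ha1).trans_le hτ.1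
      have hτb : τ ≤ b := hτ.2.trans (max_le ht.2.le h1b)
      rcases hτb.lt_or_eq with h | h
      · filter_upwards [hgen τ ⟨haτ, h⟩] with m hm h1 _ using hm h1
      · have hbt : max t 1 = 1 := max_eq_right <| by
          by_contra h'
          rw [max_eq_left (not_le.1 h').le] at hτ
          linarith [hτ.2, ht.2]
        rw [hbt] at hτ ⊢
        obtain rfl : τ = 1 := le_antisymm hτ.2 (h ▸ h1b)
        filter_upwards [hblock 1 ha1, hC1, hvert, isClosed_closure.isOpen_compl.mem_nhds
          (hmax 1 ⟨ha1, le_rfl⟩)] with m h1 h2 h3 h4 h5 h6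
        rcases h6.2.lt_or_eq with h7 | h7
        · refine ⟨?_, fun h => h.elim (h1 h5) h2⟩
          by_contra hm
          exact h4 (subset_closure ⟨hm, h7, h5⟩)
        · rw [show m = (1, m.2) from Prod.ext h7 rfl]
          exact hs m.2 ⟨h5, h3.le⟩
    · refine exists_preconnected_box (a := 1) (b := t) ⟨le_rfl, ht.1.le⟩ ⟨ht.1.le, le_rfl⟩
        fun τ hτ => ?_
      rcases hτ.1.lt_or_eq with h | rfl
      · filter_upwards [hgen τ ⟨h, hτ.2.trans_lt ht.2⟩] with m hm h1 _ using hm h1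
      · have hq2 : ∀ᶠ m in 𝓝 ((1 : ℝ), (0 : ℝ)), m.2 < q.2 :=
          continuousAt_snd.eventually_lt_const hqQ.2
        filter_upwards [eventually_mem_of_tip hR hcone htwo hreg hz hsR haQ, hC1, hvert, hq2]
          with m h1 h2 h3 h4 h5 h6
        rcases h6.1.lt_or_eq with h7 | h7
        · have hq2 := hqQ.2
          have hq1 := hqQ.1
          refine ⟨h1 h7, fun h => h.elim ?_ h2⟩
          refine notMem_starAt_of_ray one_pos hq (k := m.2 / q.2)
            ⟨div_pos h5 hq2, (div_le_one hq2).2 h4.le⟩ (by field_simp) ?_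
          have : m.2 / q.2 * (q.1 - 1) < 0 := mul_neg_of_pos_of_neg (div_pos h5 hq2) (by linarith)
          linarith
        · rw [show m = (1, m.2) from Prod.ext h7.symm rfl]
          exact hs m.2 ⟨h5, h3.le⟩
  refine ⟨a, b, hab, ⟨ha1, h1b⟩, haf, hbf, hint, fun t ht => hstar t ⟨ha0.le.trans ht.1, ht.2⟩,
    ?_⟩
  set K := connectedComponentIn (R \ (starAt R 0 ∪ C)) (1, 1)
  have hopen : ∀ t ∈ Ioo a b, (t, (0 : ℝ)) ∈ closure K := by
    intro t ht
    obtain ⟨G, hG, hGp, ⟨s, hs', hsG⟩, hcl⟩ := hbox t ht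
    have hvert : (fun s : ℝ => ((1 : ℝ), s)) '' Ioc 0 1 ⊆ K := by
      refine IsPreconnected.subset_connectedComponentIn
        (isPreconnected_Ioc.image _ (by fun_prop)) ⟨1, ⟨one_pos, le_rfl⟩, rfl⟩ ?_
      rintro _ ⟨s, h, rfl⟩
      exact hs s h
    have h1 : (1, s) ∈ K := hvert ⟨s, hs', rfl⟩
    have h2 : G ⊆ K := by
      have := hGp.subset_connectedComponentIn hsG hG
      rwa [← connectedComponentIn_eq h1] at this
    exact closure_mono h2 hcl
  have hcl : IsClosed {t | (t, (0 : ℝ)) ∈ closure K} :=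
    isClosed_closure.preimage (by fun_prop)
  intro t ht
  have := hcl.closure_subset_iff.2 (show Ioo a b ⊆ _ from hopen)
  rw [closure_Ioo hab.ne] at this
  exact this ht

section Segments

variable {E : Type*} [NormedAddCommGroup E] [NormedSpace ℝ E]

theorem eventually_mem_segment_of_lineMap_mem (p b : E) :
    ∀ᶠ q in 𝓝 p, ∀ l ∈ Ioc (0 : ℝ) 1, AffineMap.lineMap p q l ∈ segment ℝ p b →
      q ∈ segment ℝ p b := by
  by_cases hpb : b = p
  · subst hpb
    refine Filter.Eventually.of_forall fun q l hl h => ?_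
    rw [segment_same, mem_singleton_iff, AffineMap.lineMap_eq_left_iff] at h
    rcases h with h | h
    · simp [h]
    · exact absurd h hl.1.ne'
  · have hpos : 0 < ‖b - p‖ := norm_pos_iff.2 (sub_ne_zero.2 hpb)
    filter_upwards [Metric.ball_mem_nhds p hpos] with q hq l hl h
    rw [mem_ball_iff_norm] at hq
    rw [segment_eq_image_lineMap] at h ⊢
    obtain ⟨k, hk, hkl⟩ := h
    have hl0 := hl.1
    simp only [AffineMap.lineMap_apply, vsub_eq_sub, vadd_eq_add, add_left_inj] at hkl
    have hqp : q - p = (k / l) • (b - p) := by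
      rw [div_eq_inv_mul, mul_smul, hkl, inv_smul_smul₀ hl0.ne']
    have hkl0 : 0 ≤ k / l := div_nonneg hk.1 hl0.le
    refine ⟨k / l, ⟨hkl0, ?_⟩, ?_⟩
    · rw [hqp, norm_smul, Real.norm_of_nonneg hkl0] at hq
      by_contra h1
      nlinarith [not_le.1 h1]
    · simp only [AffineMap.lineMap_apply, vsub_eq_sub, vadd_eq_add, ← hqp, sub_add_cancel]

theorem segment_subset_union_of_mem {a b p : E} (hp : p ∈ segment ℝ a b) :
    segment ℝ a b ⊆ segment ℝ p a ∪ segment ℝ p b := by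
  rw [segment_eq_image_lineMap] at hp
  obtain ⟨τ, hτ, rfl⟩ := hp
  intro q hq
  rw [segment_eq_image_lineMap] at hq
  obtain ⟨σ, hσ, rfl⟩ := hq
  have h0 : AffineMap.lineMap a b (0 : ℝ) = a := by simp
  have h1 : AffineMap.lineMap a b (1 : ℝ) = b := by simp
  rcases le_total σ τ with h | h
  · left
    rw [segment_symm]
    nth_rewrite 1 [← h0]
    rw [← image_segment, segment_eq_Icc hτ.1]
    exact ⟨σ, ⟨hσ.1, h⟩, rfl⟩
  · right
    nth_rewrite 2 [← h1]
    rw [← image_segment, segment_eq_Icc hτ.2]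
    exact ⟨σ, ⟨h, hσ.2⟩, rfl⟩

theorem isCompact_segment (a b : E) : IsCompact (segment ℝ a b) := by
  rw [segment_eq_image_lineMap]
  exact isCompact_Icc.image AffineMap.lineMap_continuous

theorem locallyConic_segment (a b : E) : LocallyConic (segment ℝ a b) := by
  intro p
  by_cases hp : p ∈ segment ℝ a b
  · filter_upwards [eventually_mem_segment_of_lineMap_mem p a,
      eventually_mem_segment_of_lineMap_mem p b] with q h1 h2 l hl
    have hsub1 := (convex_segment a b).segment_subset hp (left_mem_segment ℝ a b)
    have hsub2 := (convex_segment a b).segment_subset hp (right_mem_segment ℝ a b)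
    constructor
    · intro h
      exact (segment_subset_union_of_mem hp h).elim (fun h => hsub1 (h1 l hl h))
        (fun h => hsub2 (h2 l hl h))
    · intro h
      exact (convex_segment a b).segment_subset hp h (lineMap_mem_segment ℝ _ _ ⟨hl.1.le, hl.2⟩)
  · obtain ⟨r, hr, hball⟩ := Metric.isOpen_iff.1 (isCompact_segment a b).isClosed.isOpen_compl p hp
    filter_upwards [Metric.ball_mem_nhds p hr] with q hq l hl
    refine iff_of_false (hball ?_) (hball hq)
    exact (convex_ball p r).segment_subset (Metric.mem_ball_self hr) hq
      (lineMap_mem_segment ℝ _ _ ⟨hl.1.le, hl.2⟩)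

theorem mem_rays_of_mem_segment {a b p q : E} (hp : p ∈ segment ℝ a b) (hq : q ∈ segment ℝ a b) :
    ∃ s : ℝ, 0 ≤ s ∧ (q = AffineMap.lineMap p a s ∨ q = AffineMap.lineMap p b s) := by
  rcases segment_subset_union_of_mem hp hq with h | h <;>
  · rw [segment_eq_image_lineMap] at h
    obtain ⟨s, hs, rfl⟩ := h
    exact ⟨s, hs.1, by simp⟩

end Segments

namespace SimplePolygon

variable (P : SimplePolygon)

theorem isClosed_boundary : IsClosed P.boundary :=
  isClosed_biUnion_finset fun _ _ => (isCompact_segment _ _).isClosed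

theorem isBounded_boundary : Bornology.IsBounded P.boundary := by
  unfold boundary
  rw [Bornology.isBounded_biUnion_finset]
  exact fun _ _ => (isCompact_segment _ _).isBounded

theorem boundary_subset_region : P.boundary ⊆ P.region := subset_union_left

theorem mem_region_iff_of_mem_component {p q : Plane}
    (h : q ∈ connectedComponentIn P.boundaryᶜ p) : q ∈ P.region ↔ p ∈ P.region := by
  have hq : q ∉ P.boundary := connectedComponentIn_subset _ _ h
  have hp : p ∉ P.boundary := mem_compl_iff _ _ |>.1 <| by
    by_contra h'
    rw [connectedComponentIn_eq_empty h'] at h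
    exact h
  simp only [region, mem_union, hq, hp, false_or, mem_ofPred_eq, not_false_eq_true, true_and]
  rw [connectedComponentIn_eq h]

theorem mem_region_iff_of_isPreconnected {S : Set Plane} (hS : IsPreconnected S)
    (hd : ∀ m ∈ S, m ∉ P.boundary) {p q : Plane} (hp : p ∈ S) (hq : q ∈ S) :
    q ∈ P.region ↔ p ∈ P.region :=
  P.mem_region_iff_of_mem_component (hS.subset_connectedComponentIn hp hd hq)

theorem component_mem_nhds {p : Plane} (hp : p ∉ P.boundary) :
    connectedComponentIn P.boundaryᶜ p ∈ 𝓝 p :=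
  P.isClosed_boundary.isOpen_compl.connectedComponentIn.mem_nhds (mem_connectedComponentIn hp)

theorem isClosed_region : IsClosed P.region := by
  rw [← isOpen_compl_iff, isOpen_iff_mem_nhds]
  intro p hp
  filter_upwards [P.component_mem_nhds fun h => hp (P.boundary_subset_region h)] with q hq
  exact fun h => hp ((P.mem_region_iff_of_mem_component hq).1 h)

theorem frontier_region_subset : frontier P.region ⊆ P.boundary := by
  intro p hp
  by_contra hb
  rw [P.isClosed_region.frontier_eq] at hp
  refine hp.2 (mem_interior_iff_mem_nhds.2 ?_)
  filter_upwards [P.component_mem_nhds hb] with q hq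
  exact (P.mem_region_iff_of_mem_component hq).2 hp.1

theorem isBounded_region : Bornology.IsBounded P.region := by
  obtain ⟨C, hC0, hC⟩ := P.isBounded_boundary.exists_pos_norm_le
  refine isBounded_iff_forall_norm_le.2 ⟨C, fun p hp => ?_⟩
  by_contra hpC
  rw [not_le] at hpC
  have hpb : p ∉ P.boundary := fun h => (hC p h).not_gt hpC
  have hbd := (hp.resolve_left hpb).2
  obtain ⟨D, hD⟩ := hbd.exists_norm_le
  have hray : (fun t : ℝ => t • p) '' Ici 1 ⊆ connectedComponentIn P.boundaryᶜ p := by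
    refine (isPreconnected_Ici.image _ (by fun_prop)).subset_connectedComponentIn
      ⟨1, mem_Ici.2 le_rfl, one_smul _ _⟩ ?_
    rintro _ ⟨t, ht, rfl⟩ hb
    have h1 := hC _ hb
    have ht : (1 : ℝ) ≤ t := ht
    simp only [norm_smul, Real.norm_of_nonneg (zero_le_one.trans ht)] at h1
    nlinarith
  have hp0 : 0 < ‖p‖ := hC0.trans hpC
  have h2 := hD _ (hray ⟨max 1 ((D + 1) / ‖p‖), mem_Ici.2 (le_max_left _ _), rfl⟩)
  have h3 : (D + 1) / ‖p‖ ≤ max 1 ((D + 1) / ‖p‖) := le_max_right _ _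
  have h4 : (0 : ℝ) ≤ max 1 ((D + 1) / ‖p‖) := zero_le_one.trans (le_max_left _ _)
  simp only [norm_smul, Real.norm_of_nonneg h4] at h2
  rw [div_le_iff₀ hp0] at h3
  linarith

theorem mem_boundary {p : Plane} : p ∈ P.boundary ↔
    ∃ i < P.n, p ∈ segment ℝ (P.vertex i) (P.vertex (i + 1)) := by
  simp [boundary]

theorem locallyConic_boundary : LocallyConic P.boundary := by
  intro p
  have : ∀ᶠ q in 𝓝 p, ∀ i ∈ Finset.range P.n, ∀ l ∈ Ioc (0 : ℝ) 1,
      (AffineMap.lineMap p q l ∈ segment ℝ (P.vertex i) (P.vertex (i + 1)) ↔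
        q ∈ segment ℝ (P.vertex i) (P.vertex (i + 1))) :=
    (Filter.eventually_all_finset _).2 fun i _ => locallyConic_segment _ _ p
  filter_upwards [this] with q hq l hl
  simp only [mem_boundary]
  exact exists_congr fun i => and_congr_right fun hi => hq i (Finset.mem_range.2 hi) l hl

theorem locallyConic_region : LocallyConic P.region := by
  intro p
  filter_upwards [P.locallyConic_boundary p] with q hq l hl
  by_cases hqb : q ∈ P.boundary
  · exact iff_of_true (P.boundary_subset_region ((hq l hl).2 hqb)) (P.boundary_subset_region hqb)
  · refine P.mem_region_iff_of_isPreconnected (S := AffineMap.lineMap p q '' Ioc (0 : ℝ) 1)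
      (isPreconnected_Ioc.image _ AffineMap.lineMap_continuous.continuousOn) ?_
      ⟨1, ⟨one_pos, le_rfl⟩, by simp⟩ ⟨l, hl, rfl⟩
    rintro _ ⟨k, hk, rfl⟩ h
    exact hqb ((hq k hk).1 h)

theorem eventually_notMem_edges (p : Plane) : ∀ᶠ q in 𝓝 p, ∀ i ∈ Finset.range P.n,
    q ∈ segment ℝ (P.vertex i) (P.vertex (i + 1)) →
    p ∈ segment ℝ (P.vertex i) (P.vertex (i + 1)) := by
  refine (Filter.eventually_all_finset _).2 fun i _ => ?_
  by_cases h : p ∈ segment ℝ (P.vertex i) (P.vertex (i + 1))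
  · exact Filter.Eventually.of_forall fun _ _ => h
  · filter_upwards [(isCompact_segment _ _).isClosed.isOpen_compl.mem_nhds h] with q hq hq'
    exact absurd hq' hq

theorem vertex_mod (i : ℕ) : P.vertex (i % P.n) = P.vertex i :=
  Function.Periodic.map_mod_nat P.periodic i

theorem eq_or_eq_succ_of_vertex_mem {j k : ℕ} (hj : j < P.n) (hk : k < P.n)
    (h : P.vertex k ∈ segment ℝ (P.vertex j) (P.vertex (j + 1))) :
    j = k ∨ k = (j + 1) % P.n := by
  by_contra hne
  rw [not_or] at hne
  have h3 := P.three_le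
  have hint := P.jordan j hj k hk hne.1
  have hmem : P.vertex k ∈ segment ℝ (P.vertex j) (P.vertex (j + 1)) ∩
      segment ℝ (P.vertex k) (P.vertex (k + 1)) := ⟨h, left_mem_segment ℝ _ _⟩
  rw [hint, if_neg hne.2] at hmem
  split_ifs at hmem with h1
  · rw [mem_singleton_iff, ← P.vertex_mod (k + 1)] at hmem
    have := P.inj k hk _ (Nat.mod_lt _ (by omega)) hmem
    exact hne.1 (h1.trans this.symm)
  · exact hmem

theorem locallyTwoRays_boundary : LocallyTwoRays P.boundary := by
  intro p
  have h3 := P.three_le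
  by_cases hv : ∃ k < P.n, P.vertex k = p
  · obtain ⟨k, hk, rfl⟩ := hv
    obtain ⟨i, hi, hik⟩ : ∃ i < P.n, (i + 1) % P.n = k := by
      rcases Nat.eq_zero_or_pos k with rfl | h0
      · exact ⟨P.n - 1, by omega, by rw [Nat.sub_add_cancel (by omega), Nat.mod_self]⟩
      · exact ⟨k - 1, by omega, by rw [Nat.sub_add_cancel h0, Nat.mod_eq_of_lt hk]⟩
    refine ⟨P.vertex i, P.vertex (k + 1), ?_⟩
    filter_upwards [P.eventually_notMem_edges (P.vertex k)] with q hq hqb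
    obtain ⟨j, hj, hqj⟩ := P.mem_boundary.1 hqb
    rcases P.eq_or_eq_succ_of_vertex_mem hj hk (hq j (Finset.mem_range.2 hj) hqj) with rfl | h
    · rw [segment_eq_image_lineMap] at hqj
      obtain ⟨s, hs, rfl⟩ := hqj
      exact ⟨s, hs.1, Or.inr rfl⟩
    · have hij : j = i := by
        have : (j + 1) % P.n = (i + 1) % P.n := by rw [hik, h]
        have : j % P.n = i % P.n := Nat.ModEq.add_right_cancel' 1 this
        rwa [Nat.mod_eq_of_lt hj, Nat.mod_eq_of_lt hi] at this
      subst hij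
      rw [← P.vertex_mod (j + 1), hik, segment_symm, segment_eq_image_lineMap] at hqj
      obtain ⟨s, hs, rfl⟩ := hqj
      exact ⟨s, hs.1, Or.inl rfl⟩
  · by_cases hp : ∃ i < P.n, p ∈ segment ℝ (P.vertex i) (P.vertex (i + 1))
    · obtain ⟨i, hi, hpi⟩ := hp
      refine ⟨P.vertex i, P.vertex (i + 1), ?_⟩
      filter_upwards [P.eventually_notMem_edges p] with q hq hqb
      obtain ⟨j, hj, hqj⟩ := P.mem_boundary.1 hqb
      have hpj := hq j (Finset.mem_range.2 hj) hqj
      have hij : i = j := by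
        by_contra hij
        have hmem : p ∈ segment ℝ (P.vertex i) (P.vertex (i + 1)) ∩
          segment ℝ (P.vertex j) (P.vertex (j + 1)) := ⟨hpi, hpj⟩
        have hend : ∀ m, p ≠ P.vertex (m + 1) := fun m h =>
          hv ⟨_, Nat.mod_lt (m + 1) (by omega), (P.vertex_mod _).trans h.symm⟩
        rw [P.jordan i hi j hj hij] at hmem
        split_ifs at hmem
        · exact hend _ hmem
        · exact hend _ hmem
        · exact hmem
      subst hij
      exact mem_rays_of_mem_segment hpi hqj
    · refine ⟨p, p, ?_⟩
      filter_upwards [P.eventually_notMem_edges p] with q hq hqb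
      obtain ⟨j, hj, hqj⟩ := P.mem_boundary.1 hqb
      exact absurd ⟨j, hj, hq j (Finset.mem_range.2 hj) hqj⟩ hp

theorem vis_eq_starAt (p : Plane) : P.Vis p = starAt P.region p := by
  ext q
  exact ⟨fun h => h.2, fun h => ⟨h (right_mem_segment ℝ _ _), h⟩⟩

theorem isClosed_vis (p : Plane) : IsClosed (P.Vis p) := by
  rw [vis_eq_starAt]
  exact P.isClosed_region.starAt p

theorem segment_subset_vis {p q : Plane} (h : q ∈ P.Vis p) : segment ℝ p q ⊆ P.Vis p := by
  intro m hm
  exact ⟨h.2 hm, ((convex_segment p q).segment_subset (left_mem_segment ℝ _ _) hm).trans h.2⟩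

end SimplePolygon

section Transfer

variable {E F : Type*} [NormedAddCommGroup E] [NormedSpace ℝ E] [NormedAddCommGroup F]
  [NormedSpace ℝ F] (φ : E ≃ᴬ[ℝ] F)

theorem ContinuousAffineEquiv.map_lineMap (p q : E) (l : ℝ) :
    φ (AffineMap.lineMap p q l) = AffineMap.lineMap (φ p) (φ q) l :=
  φ.toAffineEquiv.apply_lineMap p q l

theorem ContinuousAffineEquiv.image_segment_eq (p q : E) :
    φ '' segment ℝ p q = segment ℝ (φ p) (φ q) :=
  image_segment ℝ φ.toAffineEquiv.toAffineMap p q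

theorem LocallyConic.preimage {R : Set F} (hR : LocallyConic R) : LocallyConic (φ ⁻¹' R) := by
  intro p
  filter_upwards [φ.continuous.continuousAt.eventually (hR (φ p))] with q hq l hl
  rw [mem_preimage, mem_preimage, φ.map_lineMap]
  exact hq l hl

theorem LocallyTwoRays.preimage {B : Set F} (hB : LocallyTwoRays B) :
    LocallyTwoRays (φ ⁻¹' B) := by
  intro p
  obtain ⟨c, d, hcd⟩ := hB (φ p)
  refine ⟨φ.symm c, φ.symm d, ?_⟩
  filter_upwards [φ.continuous.continuousAt.eventually hcd] with q hq hqB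
  obtain ⟨s, hs, h⟩ := hq hqB
  refine ⟨s, hs, ?_⟩
  rwa [← φ.injective.eq_iff, ← φ.injective.eq_iff, φ.map_lineMap, φ.map_lineMap,
    φ.apply_symm_apply, φ.apply_symm_apply]

theorem LocallyTwoRays.mono {B B' : Set E} (hB : LocallyTwoRays B) (h : B' ⊆ B) :
    LocallyTwoRays B' := by
  intro p
  obtain ⟨c, d, hcd⟩ := hB p
  exact ⟨c, d, hcd.mono fun q hq hqB => hq (h hqB)⟩

theorem starAt_preimage (R : Set F) (p : E) : starAt (φ ⁻¹' R) p = φ ⁻¹' starAt R (φ p) := by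
  ext q
  simp only [starAt, mem_ofPred_eq, mem_preimage, ← φ.image_segment_eq, image_subset_iff]

end Transfer

/-- The affine coordinate system with origin `v` and basis `a`, `b`. -/
theorem exists_affine_coordinates (v a b : Plane)
    (hab : ∀ s t : ℝ, s • a + t • b = 0 → s = 0 ∧ t = 0) :
    ∃ φ : (ℝ × ℝ) ≃ᴬ[ℝ] Plane, ∀ m : ℝ × ℝ, φ m = v + (m.1 • a + m.2 • b) := by
  let L : ℝ × ℝ →ₗ[ℝ] Plane :=
    (LinearMap.fst ℝ ℝ ℝ).smulRight a + (LinearMap.snd ℝ ℝ ℝ).smulRight b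
  have hL : Function.Injective L := by
    rw [← LinearMap.ker_eq_bot, LinearMap.ker_eq_bot']
    intro m hm
    obtain ⟨h1, h2⟩ := hab m.1 m.2 (by simpa [L] using hm)
    exact Prod.ext h1 h2
  have hdim : Module.finrank ℝ (ℝ × ℝ) = Module.finrank ℝ Plane := by simp
  refine ⟨(L.linearEquivOfInjective hL hdim).toContinuousLinearEquiv.toContinuousAffineEquiv.trans
    (ContinuousAffineEquiv.constVAdd ℝ Plane v), fun m => ?_⟩
  simp [L]
  rfl

namespace SimplePolygon

variable (P : SimplePolygon)

/-- A point `z` of `Vis v` approached along `(z, x]` from outside `Vis v` lies on a window. -/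
theorem exists_window {C : Set Plane} {v z x : Plane} (hreg : P.VisRegular v)
    (hz : z ∈ P.Vis v) (hC : IsClosed C) (hVC : Disjoint (P.Vis v) C)
    (hx : ∀ s ∈ Ioc (0 : ℝ) 1, AffineMap.lineMap z x s ∈ P.region \ (P.Vis v ∪ C)) :
    ∃ e, P.IsWindow v e ∧ z ∈ e ∧
      e ⊆ closure (connectedComponentIn (P.region \ (P.Vis v ∪ C)) x) := by
  have hzR := hz.1
  have hseg : segment ℝ z x ⊆ P.region := by
    rw [segment_eq_image_lineMap]
    rintro _ ⟨s, hs, rfl⟩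
    rcases hs.1.eq_or_lt with rfl | h
    · simpa using hzR
    · exact (hx s ⟨h, hs.2⟩).1
  have hxV : x ∉ P.Vis v := by
    have := (hx 1 ⟨one_pos, le_rfl⟩).2
    rw [AffineMap.lineMap_apply_one] at this
    exact fun h => this (Or.inl h)
  have hcol : ∀ k : ℝ, x - z ≠ k • (z - v) := by
    intro k hk
    refine hxV ⟨hseg (right_mem_segment ℝ _ _), ?_⟩
    have hxk : x = z + k • (z - v) := by rw [← hk]; abel
    rw [segment_eq_image_lineMap]
    rintro _ ⟨θ, hθ, rfl⟩
    by_cases h : θ * (1 + k) ∈ Icc (0 : ℝ) 1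
    · refine hz.2 ?_
      rw [segment_eq_image_lineMap]
      refine ⟨_, h, ?_⟩
      rw [AffineMap.lineMap_apply_module', AffineMap.lineMap_apply_module', hxk]
      module
    · have hk0 : k ≠ 0 := by
        rintro rfl
        exact h ⟨by linarith [hθ.1], by linarith [hθ.2]⟩
      refine hseg ?_
      rw [segment_eq_image_lineMap]
      refine ⟨(θ * (1 + k) - 1) / k, ?_, ?_⟩
      · rw [mem_Icc, not_and_or, not_le, not_le] at h
        have hθ0 := hθ.1
        have hθ1 := hθ.2
        rcases h with h | h
        · have hk1 : 1 + k < 0 := by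
            by_contra h'
            exact h.not_ge (mul_nonneg hθ0 (not_lt.1 h'))
          exact ⟨div_nonneg_of_nonpos (by linarith) (by linarith),
            (div_le_one_of_neg (by linarith)).2 (by nlinarith)⟩
        · have hk1 : 0 < k := by
            by_contra h'
            nlinarith
          exact ⟨div_nonneg (by linarith) hk1.le, (div_le_one hk1).2 (by nlinarith)⟩
      · have e : ((θ * (1 + k) - 1) / k) • (x - z) = (θ * (1 + k) - 1) • (z - v) := by
          rw [hk, smul_smul, div_mul_cancel₀ _ hk0]
        rw [AffineMap.lineMap_apply_module', AffineMap.lineMap_apply_module', e, hxk]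
        module
  have hzv : z ≠ v := by
    rintro rfl
    exact hxV ⟨hseg (right_mem_segment ℝ _ _), hseg⟩
  obtain ⟨φ, hφ⟩ := exists_affine_coordinates v (z - v) (x - z) <| by
    intro s t hst
    have ht : t = 0 := by
      by_contra ht
      refine hcol (-s / t) ?_
      have h1 : t • (x - z) = (-s) • (z - v) := by
        rw [neg_smul]; exact eq_neg_of_add_eq_zero_right hst
      rw [div_eq_inv_mul, mul_smul, ← h1, inv_smul_smul₀ ht]
    subst ht
    rw [zero_smul, add_zero, smul_eq_zero] at hst
    exact ⟨hst.resolve_right (sub_ne_zero.2 hzv), rfl⟩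
  have hφ0 : φ 0 = v := by simp [hφ]
  have hφz : φ (1, 0) = z := by simp [hφ]
  have hφx : φ (1, 1) = x := by simp [hφ]
  have hφs : ∀ s : ℝ, φ (1, s) = AffineMap.lineMap z x s := by
    intro s
    rw [hφ, AffineMap.lineMap_apply_module', one_smul]
    module
  have hstar : starAt (φ ⁻¹' P.region) 0 = φ ⁻¹' P.Vis v := by
    rw [starAt_preimage, hφ0, vis_eq_starAt]
  have hint : ∀ S : Set Plane, φ ⁻¹' interior S = interior (φ ⁻¹' S) :=
    φ.toHomeomorph.preimage_interior
  have hcl : ∀ S : Set Plane, φ ⁻¹' closure S = closure (φ ⁻¹' S) :=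
    φ.toHomeomorph.preimage_closure
  have hfr : ∀ S : Set Plane, φ ⁻¹' frontier S = frontier (φ ⁻¹' S) :=
    φ.toHomeomorph.preimage_frontier
  have hbdd : Bornology.IsBounded (φ ⁻¹' P.region) := by
    rw [← φ.image_symm]
    exact ((Metric.isCompact_of_isClosed_isBounded P.isClosed_region P.isBounded_region).image
      φ.symm.continuous).isBounded
  have hdiff : φ ⁻¹' P.region \ (starAt (φ ⁻¹' P.region) 0 ∪ φ ⁻¹' C) =
      φ ⁻¹' (P.region \ (P.Vis v ∪ C)) := by rw [hstar]; rfl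
  obtain ⟨a, b, hab, h1, ha, hb, hin, hst, hclos⟩ := exists_window_planar
    (R := φ ⁻¹' P.region) (C := φ ⁻¹' C) (P.isClosed_region.preimage φ.continuous) hbdd
    (P.locallyConic_region.preimage φ)
    (by
      rw [← hfr]
      exact (P.locallyTwoRays_boundary.mono P.frontier_region_subset).preimage φ)
    (by
      rw [hstar, ← hint, ← hcl]
      exact preimage_mono hreg.subset)
    (by rw [hstar, mem_preimage, hφz]; exact hz)
    (by
      intro s hs
      rw [hdiff, mem_preimage, hφs]
      exact hx s hs)
    (hC.preimage φ.continuous) (by rw [hstar]; exact hVC.preimage φ)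
  set c : ℝ → Plane := fun t => φ (t, 0) with hc
  have hcinj : Function.Injective c := fun s t h => (Prod.ext_iff.1 (φ.injective h)).1
  have he : segment ℝ (c a) (c b) = c '' Icc a b := by
    have h2 : segment ℝ (a, (0 : ℝ)) (b, 0) = (fun t => (t, (0 : ℝ))) '' Icc a b := by
      rw [← segment_eq_Icc hab.le, ← Prod.image_mk_segment_left]
    rw [hc, ← φ.image_segment_eq, h2, image_image]
  set K := connectedComponentIn (P.region \ (P.Vis v ∪ C)) x with hK
  have hsubK : segment ℝ (c a) (c b) ⊆ closure K := by
    rw [he]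
    rintro _ ⟨t, ht, rfl⟩
    have h2 := hclos t ht
    rw [hdiff] at h2
    refine closure_mono ?_ (image_closure_subset_closure_image φ.continuous (mem_image_of_mem φ h2))
    have hmem : ((1 : ℝ), (1 : ℝ)) ∈ φ ⁻¹' (P.region \ (P.Vis v ∪ C)) := by
      rw [mem_preimage, hφs]
      exact hx 1 ⟨one_pos, le_rfl⟩
    have h3 := φ.continuous.continuousOn.image_connectedComponentIn_subset hmem
    rwa [φ.image_preimage, hφx] at h3
  have hsubV : segment ℝ (c a) (c b) ⊆ P.Vis v := by
    rw [he]
    rintro _ ⟨t, ht, rfl⟩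
    have := hst t ht
    rwa [hstar] at this
  have hcf : ∀ t ∈ Icc a b, c t ∈ frontier P.region ↔ t = a ∨ t = b := by
    intro t ht
    constructor
    · intro h
      by_contra h'
      rw [not_or] at h'
      have h2 := hin t ⟨lt_of_le_of_ne ht.1 (Ne.symm h'.1), lt_of_le_of_ne ht.2 h'.2⟩
      rw [← hint] at h2
      exact h.2 h2
    · rw [← hfr] at ha hb
      rintro (rfl | rfl)
      · exact ha
      · exact hb
  have hends : segment ℝ (c a) (c b) ∩ frontier P.region = {c a, c b} := by
    ext m
    rw [he]
    constructor
    · rintro ⟨⟨t, ht, rfl⟩, hf⟩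
      rcases (hcf t ht).1 hf with rfl | rfl
      · exact Or.inl rfl
      · exact Or.inr rfl
    · rintro (rfl | rfl)
      · exact ⟨⟨a, ⟨le_rfl, hab.le⟩, rfl⟩, (hcf a ⟨le_rfl, hab.le⟩).2 (Or.inl rfl)⟩
      · exact ⟨⟨b, ⟨hab.le, le_rfl⟩, rfl⟩, (hcf b ⟨hab.le, le_rfl⟩).2 (Or.inr rfl)⟩
  refine ⟨segment ℝ (c a) (c b), ⟨c a, c b, hcinj.ne hab.ne, rfl, ?_, hends, ?_⟩, ?_, hsubK⟩
  · intro m hm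
    rw [frontier_eq_closure_inter_closure]
    refine ⟨subset_closure (hsubV hm), closure_mono ?_ (hsubK hm)⟩
    exact fun p hp h => (connectedComponentIn_subset _ _ hp).2 (Or.inl h)
  · intro a' b' _ _ hends' hsub
    have hne : c a ≠ c b := hcinj.ne hab.ne
    have hmem : ∀ m ∈ ({c a, c b} : Set Plane), m ∈ ({a', b'} : Set Plane) := by
      intro m hm
      rw [← hends] at hm
      rw [← hends']
      exact ⟨hsub hm.1, hm.2⟩
    rcases hmem (c a) (Or.inl rfl) with h | h <;> rcases hmem (c b) (Or.inr rfl) with h' | h'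
    · exact absurd (h.trans h'.symm) hne
    · rw [h, h']
    · rw [h, h', segment_symm]
    · exact absurd (h.trans h'.symm) hne
  · rw [he]
    exact ⟨1, h1, hφz⟩

end SimplePolygon

/-- If a point of `Vis w` is visible from a point of `Vis v'`, then it is
visible from a point of an attachment window of some neighbor `v` of `w`. -/
theorem visible_through_neighbor_window (P : SimplePolygon) (W : Set Plane)
    (hW : P.IsWitnessSet W) (hreg : ∀ u ∈ W, P.VisRegular u)
    (w v' : Plane) (hw : w ∈ W) (hv' : v' ∈ W) (hne : w ≠ v')
    (x y : Plane) (hx : x ∈ P.Vis w) (hy : y ∈ P.Vis v') (hvis : P.Visible x y) :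
    ∃ v : Plane, P.GConAdj W w v ∧
      ∃ NV : Set Plane, IsCompOf NV (P.NVis W) ∧ P.Attached NV w ∧ P.Attached NV v ∧
        ∃ e : Set Plane, P.IsWindow v e ∧ e ⊆ closure NV ∧
          ∃ z ∈ e, P.Visible z x := by
  obtain ⟨hfin, hWR, hdisj⟩ := hW
  set c : ℝ → Plane := fun t => AffineMap.lineMap x y t with hc
  have hcc : Continuous c := AffineMap.lineMap_continuous
  have hcR : ∀ t ∈ Icc (0 : ℝ) 1, c t ∈ P.region := fun t ht =>
    hvis.2.2 (lineMap_mem_segment ℝ x y ht)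
  have hclosed : ∀ S ⊆ W, IsClosed (⋃ u ∈ S, P.Vis u) := fun S hS =>
    (hfin.subset hS).isClosed_biUnion fun u _ => P.isClosed_vis u
  -- the last point of the segment in `Vis w`
  obtain ⟨t₀, ⟨ht₀V, ht₀⟩, hmax⟩ := (isCompact_Icc.inter_left
    ((P.isClosed_vis w).preimage hcc)).exists_isGreatest
    (⟨0, by simpa [hc] using hx, le_rfl, zero_le_one⟩ :
      (c ⁻¹' P.Vis w ∩ Icc (0 : ℝ) 1).Nonempty)
  -- the first later point in another visibility region
  obtain ⟨t₁, ⟨ht₁V, ht₁⟩, hmin⟩ := (isCompact_Icc.inter_left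
    ((hclosed (W \ {w}) sdiff_subset).preimage hcc)).exists_isLeast
    (⟨1, mem_biUnion (⟨hv', hne.symm⟩ : v' ∈ W \ {w}) (by simpa [hc] using hy), ht₀.2, le_rfl⟩ :
      (c ⁻¹' (⋃ u ∈ W \ {w}, P.Vis u) ∩ Icc t₀ 1).Nonempty)
  obtain ⟨v, ⟨hvW, hvw⟩, ht₁v⟩ := mem_iUnion₂.1 ht₁V
  have hvw : w ≠ v := fun h => hvw h.symm
  have h01 : t₀ < t₁ := by
    refine lt_of_le_of_ne ht₁.1 ?_
    rintro rfl
    have : c t₀ ∈ P.Vis w ∩ P.Vis v := ⟨ht₀V, ht₁v⟩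
    rw [hdisj w hw v hvW hvw] at this
    exact this
  have hgap : ∀ t ∈ Ioo t₀ t₁, c t ∈ P.NVis W := by
    intro t ht
    have ht1 : t ≤ 1 := ht.2.le.trans ht₁.2
    refine ⟨hcR t ⟨ht₀.1.trans ht.1.le, ht1⟩, fun h => ?_⟩
    obtain ⟨u, hu, htu⟩ := mem_iUnion₂.1 h
    by_cases huw : u = w
    · subst huw
      exact ht.1.not_ge (hmax ⟨htu, ht₀.1.trans ht.1.le, ht1⟩)
    · exact ht.2.not_ge (hmin ⟨mem_biUnion (⟨hu, huw⟩ : u ∈ W \ {w}) htu, ht.1.le, ht1⟩)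
  set τ := (t₀ + t₁) / 2 with hτ
  have hτI : τ ∈ Ioo t₀ t₁ := ⟨by linarith, by linarith⟩
  have hNVis : P.NVis W = P.region \ (P.Vis v ∪ ⋃ u ∈ W \ {v}, P.Vis u) := by
    rw [SimplePolygon.NVis, ← biUnion_insert, insert_sdiff_singleton, insert_eq_of_mem hvW]
  obtain ⟨e, hwin, hze, hecl⟩ := P.exists_window (C := ⋃ u ∈ W \ {v}, P.Vis u) (x := c τ)
    (hreg v hvW) ht₁v (hclosed _ sdiff_subset)
    (by
      rw [disjoint_iUnion₂_right]
      intro u hu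
      rw [disjoint_iff_inter_eq_empty]
      exact hdisj v hvW u hu.1 fun h => hu.2 h.symm)
    (by
      intro s hs
      rw [← hNVis]
      have : AffineMap.lineMap (c t₁) (c τ) s = c (AffineMap.lineMap t₁ τ s) :=
        ((AffineMap.lineMap x y : ℝ →ᵃ[ℝ] Plane).apply_lineMap t₁ τ s).symm
      rw [this]
      refine hgap _ ?_
      rw [AffineMap.lineMap_apply_module', smul_eq_mul]
      constructor <;> nlinarith [hs.1, hs.2, hτI.1, hτI.2])
  rw [← hNVis] at hecl
  have hsub : c '' Ioo t₀ t₁ ⊆ connectedComponentIn (P.NVis W) (c τ) := by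
    refine (isPreconnected_Ioo.image _ hcc.continuousOn).subset_connectedComponentIn
      ⟨τ, hτI, rfl⟩ ?_
    rintro _ ⟨t, ht, rfl⟩
    exact hgap t ht
  have hsubcl : ∀ t ∈ Icc t₀ t₁, c t ∈ closure (connectedComponentIn (P.NVis W) (c τ)) := by
    intro t ht
    rw [← closure_Ioo h01.ne] at ht
    exact closure_mono hsub (image_closure_subset_closure_image hcc ⟨t, ht, rfl⟩)
  refine ⟨v, ⟨hw, hvW, hvw, ?_⟩, connectedComponentIn (P.NVis W) (c τ), ⟨_, hgap τ hτI, rfl⟩,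
    ⟨_, hsubcl t₀ ⟨le_rfl, h01.le⟩, ht₀V⟩, ⟨_, hsubcl t₁ ⟨h01.le, le_rfl⟩, ht₁v⟩, e, hwin, hecl,
    c t₁, hze, ?_⟩
  · have hmid : segment ℝ (c t₀) (c t₁) ⊆ P.Vis w ∪ P.NVis W ∪ P.Vis v := by
      have : segment ℝ (c t₀) (c t₁) = c '' segment ℝ t₀ t₁ :=
        (image_segment ℝ (AffineMap.lineMap x y : ℝ →ᵃ[ℝ] Plane) t₀ t₁).symm
      rw [this, segment_eq_Icc h01.le]
      rintro _ ⟨t, ht, rfl⟩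
      rcases ht.1.eq_or_lt with rfl | h0
      · exact Or.inl (Or.inl ht₀V)
      rcases ht.2.eq_or_lt with rfl | h1
      · exact Or.inr ht₁v
      · exact Or.inl (Or.inr (hgap t ⟨h0, h1⟩))
    have hj : JoinedIn (P.Vis w ∪ P.NVis W ∪ P.Vis v) w v := by
      refine (JoinedIn.of_segment_subset ?_).trans
        ((JoinedIn.of_segment_subset hmid).trans (JoinedIn.of_segment_subset ?_))
      · exact (P.segment_subset_vis ht₀V).trans
          (subset_union_left.trans subset_union_left)
      · rw [segment_symm]
        exact (P.segment_subset_vis ht₁v).trans subset_union_right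
    obtain ⟨γ, hγ⟩ := hj
    exact ⟨_, γ, rfl, range_subset_iff.2 hγ⟩
  · have h1 : c t₁ ∈ segment ℝ x y := lineMap_mem_segment ℝ x y ⟨ht₀.1.trans ht₁.1, ht₁.2⟩
    exact ⟨hcR t₁ ⟨ht₀.1.trans ht₁.1, ht₁.2⟩, hvis.1,
      ((convex_segment x y).segment_subset h1 (left_mem_segment ℝ x y)).trans hvis.2.2⟩
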